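/- Let D be a digraph. If every directed cycle B in D has at least (1/2)·‖B‖ + 1 symmetric arcs, then every directed cycle in the 2-closure H = C^2(D) has a symmetric arc in H. -/

import Mathlib

open List

attribute [local instance] Classical.propDecidable

variable {V : Type*}

/-- `l` is the vertex list of a directed path from `u` to `v` in the digraph with arc
relation `A`: the vertices are pairwise distinct, consecutive vertices are joined by
arcs, the path starts at `u` and ends at `v`.  Its length (number of arcs) is
`l.length - 1`. -/
def IsPath (A : V → V → Prop) (u v : V) (l : List V) : Prop :=
  l.Nodup ∧ l.Chain' A ∧ l.head? = some u ∧ l.getLast? = some v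

/-- The arcs of a directed path given by its vertex list. -/
def pathArcs (l : List V) : List (V × V) := l.zip l.tail

/-- The distance from `u` to `v` in the digraph with arc relation `A`: the least number
of arcs on a directed `uv`-path, and `⊤` if there is no such path. -/
noncomputable def ddist (A : V → V → Prop) (u v : V) : ℕ∞ :=
  sInf {n : ℕ∞ | ∃ l : List V, IsPath A u v l ∧ (l.length : ℕ∞) = n + 1}

/-- The arcs of the directed cycle whose vertex list is `l` (consecutive pairs,
including the wrap-around arc from the last vertex to the first). -/
def cycleArcs (l : List V) : List (V × V) := l.zip (l.rotate 1)

/-- `l` is the vertex list of a directed cycle of the digraph with arc relation `A`;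
the length `‖l‖` of the cycle is `l.length`. -/
def IsCycle (A : V → V → Prop) (l : List V) : Prop :=
  2 ≤ l.length ∧ l.Nodup ∧ ∀ p ∈ cycleArcs l, A p.1 p.2

/-- The number of symmetric arcs of the cycle with vertex list `l`. -/
noncomputable def symCount (A : V → V → Prop) (l : List V) : ℕ :=
  (cycleArcs l).countP (fun p => decide (A p.2 p.1))

/-- The `m`-closure of a digraph: there is an arc from `u` to `v` iff `u ≠ v` and the
distance from `u` to `v` in `D` is at most `m`. -/
def mClosure (A : V → V → Prop) (m : ℕ) : V → V → Prop :=
  fun u v => u ≠ v ∧ ddist A u v ≤ (m : ℕ∞)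

/-- A set `S` is `k`-independent if the distance between any two distinct vertices of
`S` is at least `k`. -/
def KIndependent (A : V → V → Prop) (k : ℕ) (S : Set V) : Prop :=
  ∀ u ∈ S, ∀ v ∈ S, u ≠ v → (k : ℕ∞) ≤ ddist A u v

/-- A set `S` is `ℓ`-absorbent if every vertex outside `S` is at distance at most `ℓ`
from some vertex of `S`. -/
def LAbsorbent (A : V → V → Prop) (ℓ : ℕ) (S : Set V) : Prop :=
  ∀ u, u ∉ S → ∃ v ∈ S, ddist A u v ≤ (ℓ : ℕ∞)

/-- A `k`-kernel is a `k`-independent and `(k-1)`-absorbent set. -/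
def IsKKernel (A : V → V → Prop) (k : ℕ) (S : Set V) : Prop :=
  KIndependent A k S ∧ LAbsorbent A (k - 1) S

/-- A kernel is a `2`-kernel, i.e. an independent set that `1`-absorbs every vertex
outside of it. -/
def IsKernel (A : V → V → Prop) (S : Set V) : Prop := IsKKernel A 2 S

/-- A digraph is kernel-perfect if every induced subdigraph has a kernel. -/
def KernelPerfect (A : V → V → Prop) : Prop :=
  ∀ S : Set V, ∃ K : Set S, IsKernel (fun x y : S => A x.1 y.1) K

/-- Weight of an arc: `+1` if symmetric, `-1` otherwise. -/
noncomputable def arcWt (A : V → V → Prop) (x y : V) : ℤ := if A y x then 1 else -1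

/-- Weight of a walk. -/
noncomputable def walkWt (A : V → V → Prop) : List V → ℤ
  | [] => 0
  | [_] => 0
  | x :: y :: l => arcWt A x y + walkWt A (y :: l)

theorem walkWt_split (A : V → V → Prop) (a : List V) (y : V) (b : List V) :
    walkWt A (a ++ y :: b) = walkWt A (a ++ [y]) + walkWt A (y :: b) := by
  induction a with
  | nil => simp [walkWt]
  | cons x a ih =>
    cases a with
    | nil => simp [walkWt]
    | cons z a =>
      simp only [List.cons_append, walkWt] at ih ⊢
      rw [ih]; ring

theorem walkWt_count (A : V → V → Prop) (l : List V) (x y : V) :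
    walkWt A (x :: (l ++ [y])) =
      2 * (((x :: l).zip (l ++ [y])).countP (fun p => decide (A p.2 p.1)) : ℤ)
        - (l.length + 1) := by
  induction l generalizing x with
  | nil =>
    by_cases h : A y x <;> simp [walkWt, arcWt, h]
  | cons z l ih =>
    have := ih z
    simp only [List.cons_append, walkWt, List.zip_cons_cons, List.countP_cons,
      List.length_cons] at this ⊢
    rw [this]
    by_cases h : A z x <;> simp [arcWt, h] <;> ring

theorem chain_iff_zip (R : V → V → Prop) (l : List V) (x y : V) :
    List.IsChain R (x :: (l ++ [y])) ↔ ∀ p ∈ (x :: l).zip (l ++ [y]), R p.1 p.2 := by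
  induction l generalizing x with
  | nil => simp
  | cons z l ih =>
    have := ih z
    simp only [List.cons_append, List.zip_cons_cons, List.isChain_cons_cons,
      List.forall_mem_cons] at this ⊢
    rw [this]

theorem cycleArcs_cons (x : V) (l : List V) :
    cycleArcs (x :: l) = (x :: l).zip (l ++ [x]) := by
  simp [cycleArcs]

theorem dup_split (l : List V) (h : ¬ l.Nodup) :
    ∃ a y b c, l = a ++ y :: (b ++ y :: c) := by
  induction l with
  | nil => simp at h
  | cons x l ih =>
    by_cases hx : x ∈ l
    · obtain ⟨s, t, rfl⟩ := List.append_of_mem hx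
      exact ⟨[], x, s, t, rfl⟩
    · have : ¬ l.Nodup := fun h' => h (List.nodup_cons.2 ⟨hx, h'⟩)
      obtain ⟨a, y, b, c, rfl⟩ := ih this
      exact ⟨x :: a, y, b, c, rfl⟩

theorem closed_pos (A : V → V → Prop) (hloopless : Irreflexive A)
    (hcyc : ∀ l : List V, IsCycle A l →
      (1 / 2 : ℚ) * l.length + 1 ≤ (symCount A l : ℚ)) (n : ℕ) :
    ∀ (x : V) (l : List V), l.length = n → List.IsChain A (x :: (l ++ [x])) →
      0 < walkWt A (x :: (l ++ [x])) := by
  induction n using Nat.strong_induction_on with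
  | _ n ih =>
  intro x l hl hch
  by_cases hnd : (x :: l).Nodup
  · have hC : IsCycle A (x :: l) := by
      refine ⟨?_, hnd, ?_⟩
      · cases l with
        | nil =>
          exfalso
          simp at hch
          exact hloopless x hch
        | cons z l => simp
      · rw [cycleArcs_cons]; exact (chain_iff_zip A l x x).1 hch
    have h := hcyc _ hC
    rw [walkWt_count]
    unfold symCount at h
    rw [cycleArcs_cons] at h
    set k := List.countP (fun p : V × V => decide (A p.2 p.1)) ((x :: l).zip (l ++ [x]))
    have h2 : ((l.length : ℚ) + 1) + 2 ≤ 2 * (k : ℚ) := by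
      push_cast [List.length_cons] at h
      linarith
    have h3 : ((l.length : ℤ) + 1) + 2 ≤ 2 * (k : ℤ) := by exact_mod_cast h2
    linarith
  · obtain ⟨a, y, b, c, h⟩ := dup_split _ hnd
    have hfull : x :: (l ++ [x]) = a ++ y :: (b ++ y :: (c ++ [x])) := by
      rw [← List.cons_append, h]; simp
    have hlen := congrArg List.length h
    simp at hlen
    have hw : walkWt A (x :: (l ++ [x])) =
        walkWt A (y :: (b ++ [y])) + walkWt A (a ++ y :: (c ++ [x])) := by
      rw [hfull, walkWt_split A a y, walkWt_split A a y (c ++ [x]),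
        ← List.cons_append, walkWt_split A (y :: b) y]
      simp only [List.cons_append]
      ring
    rw [hfull] at hch
    have hch2 := (List.isChain_split (l₁ := a)).1 hch
    have hch3 := (List.isChain_split (l₁ := y :: b) (c := y) (l₂ := c ++ [x])).1 hch2.2
    have hin := ih b.length (by omega) y b rfl hch3.1
    have hout : List.IsChain A (a ++ y :: (c ++ [x])) :=
      List.isChain_split.2 ⟨hch2.1, hch3.2⟩
    have hpos : 0 < walkWt A (a ++ y :: (c ++ [x])) := by
      cases a with
      | nil =>
        simp only [List.nil_append, List.cons.injEq] at h
        obtain ⟨rfl, -⟩ := h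
        exact ih c.length (by omega) x c rfl hout
      | cons z a =>
        simp only [List.cons_append, List.cons.injEq] at h
        obtain ⟨rfl, -⟩ := h
        have := ih (a ++ y :: c).length (by simp at hlen ⊢; omega) x (a ++ y :: c) rfl
          (by simpa using hout)
        simpa using this
    rw [hw]; linarith

theorem mClosure_of_arc (A : V → V → Prop) (u v : V) (hne : u ≠ v) (h : A u v) :
    mClosure A 2 u v := by
  refine ⟨hne, le_trans (sInf_le (a := ((1 : ℕ∞))) ⟨[u, v], ⟨?_, ?_, ?_, ?_⟩, ?_⟩) ?_⟩
  · simp [hne]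
  · change List.IsChain A [u, v]
    simp [h]
  · simp
  · simp
  · norm_num
  · norm_num

theorem mClosure_of_two (A : V → V → Prop) (hloopless : Irreflexive A) (u w v : V)
    (hne : u ≠ v) (h : A u w) (h' : A w v) : mClosure A 2 u v := by
  have h1 : u ≠ w := by rintro rfl; exact hloopless _ h
  have h2 : w ≠ v := by rintro rfl; exact hloopless _ h'
  refine ⟨hne, sInf_le ⟨[u, w, v], ⟨?_, ?_, ?_, ?_⟩, ?_⟩⟩
  · simp [hne, h1, h2]
  · change List.IsChain A [u, w, v]
    simp [h, h']
  · simp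
  · simp
  · norm_num

theorem mClosure_cases (A : V → V → Prop) (u v : V) (h : mClosure A 2 u v) :
    A u v ∨ ∃ w, A u w ∧ A w v := by
  obtain ⟨hne, hd⟩ := h
  have hnon : {n : ℕ∞ | ∃ l : List V, IsPath A u v l ∧ (l.length : ℕ∞) = n + 1}.Nonempty := by
    by_contra hcon
    rw [Set.not_nonempty_iff_eq_empty] at hcon
    unfold ddist at hd
    rw [hcon, sInf_empty] at hd
    exact absurd hd (by simp)
  obtain ⟨l, ⟨hnd, hch, hh, hl⟩, hlen⟩ := csInf_mem hnon
  change List.IsChain A l at hch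
  have hlen3 : l.length ≤ 3 := by
    have : (l.length : ℕ∞) ≤ 2 + 1 := by
      rw [hlen]; exact add_le_add_left hd 1
    exact_mod_cast this
  match l, hlen3 with
  | [], _ => simp at hh
  | [a], _ =>
    simp at hh hl
    exact absurd (hh.symm.trans hl) hne
  | [a, b], _ =>
    simp at hh hl hch
    subst hh hl
    exact Or.inl hch
  | [a, b, c], _ =>
    simp at hh hl hch
    subst hh hl
    exact Or.inr ⟨b, hch⟩
  | a :: b :: c :: d :: t, h => simp at h; omega

theorem step_walk (A : V → V → Prop) (hloopless : Irreflexive A) (u v : V)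
    (h : mClosure A 2 u v) (h' : ¬ mClosure A 2 v u) :
    ∃ m : List V, List.IsChain A (u :: (m ++ [v])) ∧ walkWt A (u :: (m ++ [v])) ≤ 0 := by
  rcases mClosure_cases A u v h with h1 | ⟨w, h1, h2⟩
  · refine ⟨[], by simpa using h1, ?_⟩
    have : ¬ A v u := fun hA => h' (mClosure_of_arc A v u h.1.symm hA)
    simp [walkWt, arcWt, this]
  · refine ⟨[w], by simp [h1, h2], ?_⟩
    have : ¬ (A v w ∧ A w u) := fun hA =>
      h' (mClosure_of_two A hloopless v w u h.1.symm hA.1 hA.2)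
    by_cases h3 : A v w
    · have h4 : ¬ A w u := fun h4 => this ⟨h3, h4⟩
      simp [walkWt, arcWt, h3, h4]
    · by_cases h4 : A w u <;> simp [walkWt, arcWt, h3, h4]

theorem expand_walk (A : V → V → Prop) (hloopless : Irreflexive A) (l : List V) (x y : V)
    (h : List.IsChain (fun u v => mClosure A 2 u v ∧ ¬ mClosure A 2 v u) (x :: (l ++ [y]))) :
    ∃ m : List V, List.IsChain A (x :: (m ++ [y])) ∧ walkWt A (x :: (m ++ [y])) ≤ 0 := by
  induction l generalizing x with
  | nil =>
    simp at h
    exact step_walk A hloopless x y h.1 h.2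
  | cons z l ih =>
    simp only [List.cons_append, List.isChain_cons_cons] at h
    obtain ⟨m1, hc1, hw1⟩ := step_walk A hloopless x z h.1.1 h.1.2
    obtain ⟨m2, hc2, hw2⟩ := ih z h.2
    have e : x :: ((m1 ++ z :: m2) ++ [y]) = (x :: m1) ++ z :: (m2 ++ [y]) := by simp
    refine ⟨m1 ++ z :: m2, ?_, ?_⟩
    · rw [e]; exact List.isChain_split.2 ⟨hc1, hc2⟩
    · rw [e, walkWt_split]
      simp only [List.cons_append]
      linarith

/-- If every directed cycle `B` of `D` has at least `(1/2)·‖B‖ + 1` symmetric arcs,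
then every directed cycle of the `2`-closure `H = C²(D)` has a symmetric arc in `H`. -/
theorem closure2_cycle_symmetric_arc [Fintype V] (A : V → V → Prop)
    (hloopless : Irreflexive A)
    (hcyc : ∀ l : List V, IsCycle A l →
      (1 / 2 : ℚ) * l.length + 1 ≤ (symCount A l : ℚ))
    (B : List V) (hB : IsCycle (mClosure A 2) B) :
    ∃ p ∈ cycleArcs B, mClosure A 2 p.2 p.1 := by
  by_contra hcon
  push Not at hcon
  obtain ⟨h2, -, harc⟩ := hB
  cases B with
  | nil => simp at h2
  | cons x l =>
    rw [cycleArcs_cons] at hcon harc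
    obtain ⟨m, hm, hw⟩ := expand_walk A hloopless l x x
      ((chain_iff_zip _ l x x).2 fun p hp => ⟨harc p hp, hcon p hp⟩)
    have := closed_pos A hloopless hcyc _ x m rfl hm
    linarith
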